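/- arXiv:1509.05797 — 7 statements merged into one kernel-verified Lean document; each statement's English description precedes it below -/
import Mathlib

section
/- Let O be a class and E a class of ordered triples of elements of O. Suppose S and T are effaceable numerical δ-functors on (O, E) with S^0 = T^0. Then S^i = T^i for all i ≥ 0. -/
/-- A sequence of real numbers is a numerical exact sequence if all its terms are
nonnegative and all alternating partial sums `∑_{j=0}^{k} (-1)^j e_{k-j}` are nonnegative. -/
def NumExactSeq (e : ℕ → ℝ) : Prop :=
  (∀ k, 0 ≤ e k) ∧ ∀ k, 0 ≤ ∑ j ∈ Finset.range (k + 1), (-1 : ℝ) ^ j * e (k - j)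

/-- The interleaved sequence `T^0(A), T^0(B), T^0(C), T^1(A), T^1(B), T^1(C), …`. -/
def tripleSeq {O : Type*} (T : ℕ → O → ℝ) (A B C : O) : ℕ → ℝ := fun n =>
  if n % 3 = 0 then T (n / 3) A else if n % 3 = 1 then T (n / 3) B else T (n / 3) C

/-- `T = (T^0, T^1, …)` is a numerical δ-functor on `(O, E)` if each `T^i` takes
nonnegative values and for every triple `(A, B, C) ∈ E` the interleaved sequence
is a numerical exact sequence. -/
def IsNumDeltaFunctor {O : Type*} (E : Set (O × O × O)) (T : ℕ → O → ℝ) : Prop :=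
  (∀ i A, 0 ≤ T i A) ∧ ∀ p ∈ E, NumExactSeq (tripleSeq T p.1 p.2.1 p.2.2)

/-- A function `F : O → ℝ` is effaceable if for every `A ∈ O` and every `ε > 0`
there is a triple `(A, B, C) ∈ E` with `F(B) ≤ ε`. -/
def Effaceable {O : Type*} (E : Set (O × O × O)) (F : O → ℝ) : Prop :=
  ∀ A : O, ∀ ε : ℝ, 0 < ε → ∃ B C : O, (A, B, C) ∈ E ∧ F B ≤ ε

theorem alternating_sum_succ (e : ℕ → ℝ) (k : ℕ) :
    ∑ j ∈ Finset.range (k + 1 + 1), (-1 : ℝ) ^ j * e (k + 1 - j) =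
      e (k + 1) - ∑ j ∈ Finset.range (k + 1), (-1 : ℝ) ^ j * e (k - j) := by
  rw [Finset.sum_range_succ', sub_eq_add_neg, add_comm, ← Finset.sum_neg_distrib]
  congr 1
  · simp
  · refine Finset.sum_congr rfl fun j _ => ?_
    rw [Nat.add_sub_add_right, pow_succ]
    ring

theorem tripleSeq_three_mul {O : Type*} (T : ℕ → O → ℝ) (A B C : O) (i : ℕ) :
    tripleSeq T A B C (3 * i) = T i A := by
  have h : 3 * i / 3 = i := by omega
  simp [tripleSeq, h]

theorem tripleSeq_three_mul_add_one {O : Type*} (T : ℕ → O → ℝ) (A B C : O) (i : ℕ) :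
    tripleSeq T A B C (3 * i + 1) = T i B := by
  have h : (3 * i + 1) / 3 = i := by omega
  have h' : (3 * i + 1) % 3 = 1 := by omega
  simp [tripleSeq, h, h']

theorem tripleSeq_congr {O : Type*} {S T : ℕ → O → ℝ} {n : ℕ} (h : S (n / 3) = T (n / 3))
    (A B C : O) : tripleSeq S A B C n = tripleSeq T A B C n := by
  simp only [tripleSeq, h]

/-- If `S` and `T` agree in degrees at most `i` and `T` is effaceable in degree `i + 1`, then
`T` is bounded above by `S` in degree `i + 1`. -/
theorem IsNumDeltaFunctor.le_of_effaceable {O : Type*} {E : Set (O × O × O)} {S T : ℕ → O → ℝ}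
    (hS : IsNumDeltaFunctor E S) (hT : IsNumDeltaFunctor E T) {i : ℕ}
    (hTe : Effaceable E (T (i + 1))) (h : ∀ j ≤ i, S j = T j) (A : O) :
    T (i + 1) A ≤ S (i + 1) A := by
  refine le_of_forall_pos_le_add fun ε hε => ?_
  obtain ⟨B, C, hE, hB⟩ := hTe A ε hε
  have hSA := (hS.2 _ hE).2 (3 * i + 2 + 1)
  have hTB := (hT.2 _ hE).2 (3 * i + 2 + 1 + 1)
  have hST : ∑ j ∈ Finset.range (3 * i + 2 + 1), (-1 : ℝ) ^ j * tripleSeq S A B C (3 * i + 2 - j) =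
      ∑ j ∈ Finset.range (3 * i + 2 + 1), (-1 : ℝ) ^ j * tripleSeq T A B C (3 * i + 2 - j) :=
    Finset.sum_congr rfl fun j _ => by rw [tripleSeq_congr (h _ (by omega))]
  rw [alternating_sum_succ, hST] at hSA
  rw [alternating_sum_succ, alternating_sum_succ] at hTB
  have hA' (U : ℕ → O → ℝ) : tripleSeq U A B C (3 * i + 2 + 1) = U (i + 1) A :=
    tripleSeq_three_mul U A B C (i + 1)
  have hB' : tripleSeq T A B C (3 * i + 2 + 1 + 1) = T (i + 1) B :=
    tripleSeq_three_mul_add_one T A B C (i + 1)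
  simp only [hA', hB'] at hSA hTB
  linarith

/-- Two effaceable numerical δ-functors agreeing in degree `0` agree in all degrees. -/
theorem stmt1 {O : Type*} (E : Set (O × O × O)) (S T : ℕ → O → ℝ)
    (hS : IsNumDeltaFunctor E S) (hT : IsNumDeltaFunctor E T)
    (hSe : ∀ i, 1 ≤ i → Effaceable E (S i)) (hTe : ∀ i, 1 ≤ i → Effaceable E (T i))
    (h0 : S 0 = T 0) :
    ∀ i, S i = T i := by
  intro i
  induction i using Nat.strong_induction_on with
  | _ i ih =>
    cases i with
    | zero => exact h0
    | succ i =>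
      have h : ∀ j ≤ i, S j = T j := fun j hj => ih j (Nat.lt_succ_of_le hj)
      funext A
      exact le_antisymm
        (hT.le_of_effaceable hS (hSe _ (Nat.le_add_left 1 i)) (fun j hj => (h j hj).symm) A)
        (hS.le_of_effaceable hT (hTe _ (Nat.le_add_left 1 i)) h A)
end

section
/- Let 𝔠 be a left-exact ranked category with kernels. Suppose given morphisms a : A → A′, b : B → B′, g : B → C, g′ : B′ → C′, f : A → B, f′ : A′ → B′ such that f is a kernel of g, f′ is a kernel of g′, and b ∘ f = f′ ∘ a. Then rk(g ∘ ker(b)) = nul(b) − nul(a), where ker(b) denotes a kernel morphism of b. -/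
open CategoryTheory CategoryTheory.Limits

/-- In a left-exact ranked category with kernels, given a commutative square
`b ∘ f = f' ∘ a` where `f` is a kernel of `g` and `f'` is a kernel of `g'`, one has
`rk (g ∘ ker b) = nul b - nul a`, where `ℓ(X) = rk (𝟙 X)` and `nul h = ℓ(Ker h)`. -/
theorem stmt5 {𝔠 : Type*} [Category 𝔠] [HasZeroObject 𝔠] [HasZeroMorphisms 𝔠] [HasKernels 𝔠]
    (rk : ∀ {X Y : 𝔠}, (X ⟶ Y) → ℝ)
    (rk_nonneg : ∀ {X Y : 𝔠} (f : X ⟶ Y), 0 ≤ rk f)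
    (rk_comp_le_left : ∀ {X Y Z : 𝔠} (f : X ⟶ Y) (g : Y ⟶ Z), rk (f ≫ g) ≤ rk f)
    (rk_comp_le_right : ∀ {X Y Z : 𝔠} (f : X ⟶ Y) (g : Y ⟶ Z), rk (f ≫ g) ≤ rk g)
    (rk_leftExact : ∀ {X Y : 𝔠} (f : X ⟶ Y), rk f = rk (𝟙 X) - rk (𝟙 (kernel f)))
    {A A' B B' X X' : 𝔠}
    (a : A ⟶ A') (b : B ⟶ B') (g : B ⟶ X) (g' : B' ⟶ X')
    (f : A ⟶ B) (f' : A' ⟶ B')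
    (hfg : f ≫ g = 0) (hf : Nonempty (IsLimit (KernelFork.ofι f hfg)))
    (hfg' : f' ≫ g' = 0) (hf' : Nonempty (IsLimit (KernelFork.ofι f' hfg')))
    (hcomm : f ≫ b = a ≫ f') :
    rk (kernel.ι b ≫ g) = rk (𝟙 (kernel b)) - rk (𝟙 (kernel a)) := by
  have length_le {X Y : 𝔠} (u : X ⟶ Y) (v : Y ⟶ X) (h : u ≫ v = 𝟙 X) :
      rk (𝟙 X) ≤ rk (𝟙 Y) := by
    rw [← h]
    refine (rk_comp_le_left u v).trans ?_
    simpa using rk_comp_le_right u (𝟙 Y)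
  obtain ⟨hf⟩ := hf
  obtain ⟨hf'⟩ := hf'
  have mono_f : Mono f := Fork.IsLimit.mono hf
  have mono_f' : Mono f' := Fork.IsLimit.mono hf'
  obtain ⟨t, ht⟩ := KernelFork.IsLimit.lift' hf (kernel.ι (kernel.ι b ≫ g) ≫ kernel.ι b)
    (by rw [Category.assoc, kernel.condition])
  replace ht : t ≫ f = kernel.ι (kernel.ι b ≫ g) ≫ kernel.ι b := ht
  have hta : t ≫ a = 0 := by
    rw [← cancel_mono f', Category.assoc, ← hcomm, reassoc_of% ht, kernel.condition]
    simp
  have hab : (kernel.ι a ≫ f) ≫ b = 0 := by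
    rw [Category.assoc, hcomm, kernel.condition_assoc, zero_comp]
  have hag : kernel.lift b (kernel.ι a ≫ f) hab ≫ kernel.ι b ≫ g = 0 := by
    simp [hfg]
  have e : rk (𝟙 (kernel (kernel.ι b ≫ g))) = rk (𝟙 (kernel a)) := by
    apply le_antisymm
    · refine length_le (kernel.lift a t hta) (kernel.lift _ _ hag) ?_
      simp [← cancel_mono (kernel.ι (kernel.ι b ≫ g)), ← cancel_mono (kernel.ι b), ht]
    · refine length_le (kernel.lift _ _ hag) (kernel.lift a t hta) ?_
      simp [← cancel_mono (kernel.ι a), ← cancel_mono f, ht]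
  rw [rk_leftExact, e]
end

section
/- Let 𝔠 be a left-exact ranked category with kernels. For any morphisms b : B → B′ and g : B′ → C, one has rk(b ∘ ker(g ∘ b)) = nul(g ∘ b) − nul(b), where ker(g ∘ b) denotes a kernel morphism of g ∘ b. -/
open CategoryTheory CategoryTheory.Limits

/-- If `u ≫ v` is the identity of `X`, where `u : X ⟶ Y`, then the rank of the identity of `X` is at
most that of the identity of `Y`. -/
theorem rk_id_le_of_comp_eq_id {𝔠 : Type*} [Category 𝔠] (rk : ∀ {X Y : 𝔠}, (X ⟶ Y) → ℝ)
    (rk_comp_le_left : ∀ {X Y Z : 𝔠} (f : X ⟶ Y) (g : Y ⟶ Z), rk (f ≫ g) ≤ rk f)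
    (rk_comp_le_right : ∀ {X Y Z : 𝔠} (f : X ⟶ Y) (g : Y ⟶ Z), rk (f ≫ g) ≤ rk g)
    {X Y : 𝔠} (u : X ⟶ Y) (v : Y ⟶ X) (h : u ≫ v = 𝟙 X) : rk (𝟙 X) ≤ rk (𝟙 Y) := by
  have h1 := rk_comp_le_left u v
  have h2 := rk_comp_le_right u (𝟙 Y)
  rw [h] at h1
  rw [Category.comp_id] at h2
  exact h1.trans h2

/-- The kernel of the restriction of `b` to the kernel of `b ≫ g` is the kernel of `b`. -/
noncomputable def kernelKernelCompIso {𝔠 : Type*} [Category 𝔠] [HasZeroMorphisms 𝔠] [HasKernels 𝔠]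
    {B B' X : 𝔠} (b : B ⟶ B') (g : B' ⟶ X) :
    kernel (kernel.ι (b ≫ g) ≫ b) ≅ kernel b where
  hom := kernel.lift b (kernel.ι (kernel.ι (b ≫ g) ≫ b) ≫ kernel.ι (b ≫ g)) (by
    rw [Category.assoc, kernel.condition])
  inv := kernel.lift _ (kernel.lift (b ≫ g) (kernel.ι b) (by
    rw [kernel.condition_assoc, zero_comp])) (by
    rw [kernel.lift_ι_assoc, kernel.condition])
  hom_inv_id := by
    simp [← cancel_mono (kernel.ι (kernel.ι (b ≫ g) ≫ b)), ← cancel_mono (kernel.ι (b ≫ g))]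
  inv_hom_id := by
    simp [← cancel_mono (kernel.ι b)]

/-- In a left-exact ranked category with kernels, for morphisms `b : B ⟶ B'` and
`g : B' ⟶ C`, one has `rk (b ∘ ker (g ∘ b)) = nul (g ∘ b) - nul b`,
where `ℓ(X) = rk (𝟙 X)` and `nul h = ℓ(Ker h)`. -/
theorem stmt6 {𝔠 : Type*} [Category 𝔠] [HasZeroObject 𝔠] [HasZeroMorphisms 𝔠] [HasKernels 𝔠]
    (rk : ∀ {X Y : 𝔠}, (X ⟶ Y) → ℝ)
    (rk_nonneg : ∀ {X Y : 𝔠} (f : X ⟶ Y), 0 ≤ rk f)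
    (rk_comp_le_left : ∀ {X Y Z : 𝔠} (f : X ⟶ Y) (g : Y ⟶ Z), rk (f ≫ g) ≤ rk f)
    (rk_comp_le_right : ∀ {X Y Z : 𝔠} (f : X ⟶ Y) (g : Y ⟶ Z), rk (f ≫ g) ≤ rk g)
    (rk_leftExact : ∀ {X Y : 𝔠} (f : X ⟶ Y), rk f = rk (𝟙 X) - rk (𝟙 (kernel f)))
    {B B' X : 𝔠} (b : B ⟶ B') (g : B' ⟶ X) :
    rk (kernel.ι (b ≫ g) ≫ b) = rk (𝟙 (kernel (b ≫ g))) - rk (𝟙 (kernel b)) := by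
  let e := kernelKernelCompIso b g
  rw [rk_leftExact, le_antisymm
    (rk_id_le_of_comp_eq_id rk rk_comp_le_left rk_comp_le_right e.hom e.inv e.hom_inv_id)
    (rk_id_le_of_comp_eq_id rk rk_comp_le_left rk_comp_le_right e.inv e.hom e.inv_hom_id)]
end

section
/- Let L be a lattice in a finite-dimensional real inner product space and M a lattice in another finite-dimensional real inner product space, and let f : L → M be a group homomorphism. Then there exists a unique linear map f_ℝ : span(L) → span(M) with f_ℝ(x) = f(x) for all x ∈ L, and moreover sup_{x ∈ L, x ≠ 0} ‖f(x)‖/‖x‖ = sup_{x ∈ span(L), x ≠ 0} ‖f_ℝ(x)‖/‖x‖. -/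
theorem le_zero_of_forall_nat_mul_le {a D : ℝ} (h : ∀ n : ℕ, n * a ≤ D) : a ≤ 0 := by
  by_contra! ha
  obtain ⟨n, hn⟩ := exists_nat_gt (D / a)
  rw [div_lt_iff₀ ha] at hn
  exact absurd (h n) (not_le.mpr hn)

/-- An additive map on a full lattice extends to a linear map on the ambient space. -/
theorem IsZLattice.exists_linearMap_extension {V W : Type*}
    [NormedAddCommGroup V] [NormedSpace ℝ V] [FiniteDimensional ℝ V]
    [AddCommGroup W] [Module ℝ W]
    (Λ : Submodule ℤ V) [DiscreteTopology Λ] [IsZLattice ℝ Λ] (f : Λ →+ W) :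
    ∃ g : V →ₗ[ℝ] W, ∀ x : Λ, g x = f x := by
  let b := Module.Free.chooseBasis ℤ Λ
  let g := (b.ofZLatticeBasis ℝ Λ).constr ℝ fun i ↦ f (b i)
  refine ⟨g, fun x ↦ ?_⟩
  have h : (g.restrictScalars ℤ) ∘ₗ Λ.subtype = f.toIntLinearMap := by
    refine b.ext fun i ↦ ?_
    have hi := (b.ofZLatticeBasis ℝ Λ).constr_basis ℝ (fun i ↦ f (b i)) i
    rw [b.ofZLatticeBasis_apply ℝ Λ] at hi
    exact hi
  exact LinearMap.congr_fun h x

/-- A linear bound valid on a full lattice is valid on the whole ambient space. -/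
theorem IsZLattice.norm_le_of_forall_mem {V W : Type*}
    [NormedAddCommGroup V] [NormedSpace ℝ V] [FiniteDimensional ℝ V]
    [NormedAddCommGroup W] [NormedSpace ℝ W]
    (Λ : Submodule ℤ V) [DiscreteTopology Λ] [IsZLattice ℝ Λ] (g : V →ₗ[ℝ] W)
    {C : ℝ} (hC : 0 ≤ C) (h : ∀ x ∈ Λ, ‖g x‖ ≤ C * ‖x‖) (v : V) : ‖g v‖ ≤ C * ‖v‖ := by
  let b := (Module.Free.chooseBasis ℤ Λ).ofZLatticeBasis ℝ Λ
  have hb : Submodule.span ℤ (Set.range b) = Λ :=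
    (Module.Free.chooseBasis ℤ Λ).ofZLatticeBasis_span ℝ
  set B : ℝ := ∑ i, ‖b i‖
  set K : ℝ := ‖LinearMap.toContinuousLinearMap g‖
  have hK (w : V) : ‖g w‖ ≤ K * ‖w‖ := (LinearMap.toContinuousLinearMap g).le_opNorm w
  rw [← sub_nonpos]
  refine le_zero_of_forall_nat_mul_le (D := C * B + K * B) fun n ↦ ?_
  set w : V := (n : ℝ) • v
  have hw : ‖w‖ = n * ‖v‖ := by simp [w, norm_smul]
  have hgw : ‖g w‖ = n * ‖g v‖ := by simp [w, norm_smul]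
  set x : V := (ZSpan.floor b w).1
  set r : V := ZSpan.fract b w
  have hx : x ∈ Λ := by
    rw [← hb]
    exact (ZSpan.floor b w).2
  have hr : ‖r‖ ≤ B := ZSpan.norm_fract_le b w
  have hxr : x = w - r := by simp [x, r, ZSpan.fract_apply]
  have h_norm : ‖x‖ ≤ ‖w‖ + ‖r‖ := hxr ▸ norm_sub_le w r
  have h_split : ‖g w‖ ≤ ‖g x‖ + ‖g r‖ := by
    have : g w = g x + g r := by rw [← map_add, hxr, sub_add_cancel]
    exact this ▸ norm_add_le _ _
  have h_fract : ‖g r‖ ≤ K * B := (hK r).trans (by gcongr)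
  have h_floor : C * ‖x‖ ≤ C * (‖w‖ + B) := by gcongr; linarith
  have := h x hx
  rw [hgw] at h_split
  rw [hw] at h_floor
  linarith

/-- A group homomorphism between lattices extends uniquely to a linear map between
their spans, and the operator "norm" of the extension (as a supremum of ratios) equals
the supremum of ratios over lattice points. -/
theorem stmt7 {E F : Type*}
    [NormedAddCommGroup E] [InnerProductSpace ℝ E] [FiniteDimensional ℝ E]
    [NormedAddCommGroup F] [InnerProductSpace ℝ F] [FiniteDimensional ℝ F]
    (L : AddSubgroup E) (M : AddSubgroup F) [DiscreteTopology L] [DiscreteTopology M]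
    (f : L →+ M) :
    ∃ fR : Submodule.span ℝ (L : Set E) →ₗ[ℝ] Submodule.span ℝ (M : Set F),
      (∀ x : L, (fR ⟨(x : E), Submodule.subset_span x.2⟩ : F) = (f x : F)) ∧
      (∀ gR : Submodule.span ℝ (L : Set E) →ₗ[ℝ] Submodule.span ℝ (M : Set F),
        (∀ x : L, (gR ⟨(x : E), Submodule.subset_span x.2⟩ : F) = (f x : F)) → gR = fR) ∧
      sSup {r : ℝ | ∃ x : L, (x : E) ≠ 0 ∧ r = ‖(f x : F)‖ / ‖(x : E)‖} =
        sSup {r : ℝ | ∃ v : Submodule.span ℝ (L : Set E), (v : E) ≠ 0 ∧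
          r = ‖(fR v : F)‖ / ‖(v : E)‖} := by
  let V := Submodule.span ℝ (L : Set E)
  let Λ : Submodule ℤ V := (L.comap V.subtype.toAddMonoidHom).toIntSubmodule
  have hΛ_discrete : DiscreteTopology Λ :=
    DiscreteTopology.preimage_of_continuous_injective (L : Set E) continuous_subtype_val
      Subtype.val_injective
  have hΛ_span : Submodule.span ℝ (Λ : Set V) = ⊤ := Submodule.span_span_coe_preimage
  have hΛ : IsZLattice ℝ Λ := ⟨hΛ_span⟩
  let toL : Λ →+ L :=
    { toFun := fun x ↦ ⟨(x : V), x.2⟩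
      map_zero' := rfl
      map_add' := fun _ _ ↦ rfl }
  let toSpan : M →+ Submodule.span ℝ (M : Set F) :=
    { toFun := fun y ↦ ⟨y, Submodule.subset_span y.2⟩
      map_zero' := rfl
      map_add' := fun _ _ ↦ rfl }
  obtain ⟨fR, hfR⟩ := IsZLattice.exists_linearMap_extension Λ (toSpan.comp (f.comp toL))
  have hf (x : L) : (fR ⟨(x : E), Submodule.subset_span x.2⟩ : F) = (f x : F) :=
    congrArg Subtype.val (hfR ⟨⟨x, Submodule.subset_span x.2⟩, x.2⟩)
  refine ⟨fR, hf, fun gR hg ↦ ?_, ?_⟩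
  · refine LinearMap.ext_on hΛ_span fun x hx ↦ Subtype.ext ?_
    exact (hg ⟨x, hx⟩).trans (hf ⟨x, hx⟩).symm
  set A := {r : ℝ | ∃ x : L, (x : E) ≠ 0 ∧ r = ‖(f x : F)‖ / ‖(x : E)‖}
  set B := {r : ℝ | ∃ v : Submodule.span ℝ (L : Set E), (v : E) ≠ 0 ∧
    r = ‖(fR v : F)‖ / ‖(v : E)‖}
  have hAB : A ⊆ B := by
    rintro _ ⟨x, hx, rfl⟩
    exact ⟨⟨x, Submodule.subset_span x.2⟩, hx, by rw [hf]⟩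
  have hB_nonneg : ∀ r ∈ B, 0 ≤ r := by
    rintro _ ⟨v, -, rfl⟩
    positivity
  have hB : BddAbove B := by
    refine ⟨‖LinearMap.toContinuousLinearMap fR‖, ?_⟩
    rintro _ ⟨v, hv, rfl⟩
    rw [div_le_iff₀ (norm_pos_iff.mpr hv)]
    exact (LinearMap.toContinuousLinearMap fR).le_opNorm v
  have hA_nonneg : 0 ≤ sSup A := Real.sSup_nonneg fun r hr ↦ hB_nonneg r (hAB hr)
  apply le_antisymm
  · exact Real.sSup_le (fun r hr ↦ le_csSup hB (hAB hr)) (Real.sSup_nonneg hB_nonneg)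
  · refine Real.sSup_le ?_ hA_nonneg
    rintro _ ⟨v, hv, rfl⟩
    rw [div_le_iff₀ (norm_pos_iff.mpr hv)]
    refine IsZLattice.norm_le_of_forall_mem Λ fR hA_nonneg (fun x hx ↦ ?_) v
    by_cases hx0 : x = 0
    · simp [hx0]
    have hx0' : (x : E) ≠ 0 := fun h ↦ hx0 (Subtype.ext h)
    have hx_norm : 0 < ‖x‖ := norm_pos_iff.mpr hx0
    rw [← div_le_iff₀ hx_norm]
    refine le_csSup (hB.mono hAB) ⟨⟨x, hx⟩, hx0', ?_⟩
    rw [← hf]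
    rfl
end

section
/- (Regev–Stephens-Davidowitz inequality.) Let L be a lattice in a finite-dimensional real inner product space, and let M and N be sublattices (i.e. subgroups) of L. Then ρ(M) · ρ(N) ≤ ρ(L) · ρ(M ∩ N), where ρ(S) = Σ_{x∈S} e^{−π‖x‖²}. -/
/-- The Gaussian mass `ρ(S) = ∑_{x ∈ S} e^{-π ‖x‖²}` of a subset of a normed group. -/
noncomputable def gaussianMass {E : Type*} [NormedAddCommGroup E] (S : Set E) : ℝ :=
  ∑' x : S, Real.exp (-Real.pi * ‖(x : E)‖ ^ 2)

open scoped ENNReal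

/-- If the coordinates of the points of `R` are pairwise distinct, then `∑ H(q) H(q')` over
`(q, q') ∈ R` is at most `∑ H(q)²`. -/
theorem ENNReal.tsum_mul_le_tsum_mul_self_of_injective {Q : Type*} (R : Set (Q × Q))
    (h₁ : Function.Injective fun p : R => p.1.1) (h₂ : Function.Injective fun p : R => p.1.2)
    (H : Q → ℝ≥0∞) : ∑' p : R, H p.1.1 * H p.1.2 ≤ ∑' q, H q * H q := by
  have amgm (a b : ℝ≥0∞) : 2 * (a * b) ≤ a * a + b * b := by
    rcases eq_or_ne a ∞ with rfl | ha
    · simp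
    rcases eq_or_ne b ∞ with rfl | hb
    · simp
    lift a to NNReal using ha
    lift b to NNReal using hb
    norm_cast
    rw [← NNReal.coe_le_coe]
    push_cast
    nlinarith [sq_nonneg ((a : ℝ) - b)]
  have key : 2 * ∑' p : R, H p.1.1 * H p.1.2 ≤ 2 * ∑' q, H q * H q :=
    calc 2 * ∑' p : R, H p.1.1 * H p.1.2 = ∑' p : R, 2 * (H p.1.1 * H p.1.2) :=
          ENNReal.tsum_mul_left.symm
      _ ≤ ∑' p : R, (H p.1.1 * H p.1.1 + H p.1.2 * H p.1.2) :=
          ENNReal.tsum_le_tsum fun _ => amgm _ _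
      _ = ∑' p : R, H p.1.1 * H p.1.1 + ∑' p : R, H p.1.2 * H p.1.2 := ENNReal.tsum_add
      _ ≤ ∑' q, H q * H q + ∑' q, H q * H q :=
          add_le_add (ENNReal.tsum_comp_le_tsum_of_injective h₁ fun q => H q * H q)
            (ENNReal.tsum_comp_le_tsum_of_injective h₂ fun q => H q * H q)
      _ = 2 * ∑' q, H q * H q := (two_mul _).symm
  exact (ENNReal.mul_le_mul_iff_right two_ne_zero ENNReal.ofNat_ne_top).1 key

/-- The correlation inequality for nonnegative functions `g` on a torsion-free group admitting a
factorization `g(x) g(y) = h(x + y) h(x - y)`. -/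
theorem ENNReal.tsum_mul_tsum_le_of_mul_eq_add_sub {E : Type*} [AddCommGroup E]
    [IsAddTorsionFree E] (L M N : AddSubgroup E) (hM : M ≤ L) (hN : N ≤ L) (g h : E → ℝ≥0∞)
    (hgh : ∀ x y, g x * g y = h (x + y) * h (x - y)) :
    (∑' x : M, g x) * ∑' y : N, g y ≤ (∑' x : L, g x) * ∑' y : (M ⊓ N : AddSubgroup E), g y := by
  classical
  have inj2 {x y : E} (hxy : 2 • x = 2 • y) : x = y := nsmul_right_injective two_ne_zero hxy
  have prod (A B : AddSubgroup E) : (∑' x : A, g x) * ∑' y : B, g y =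
      ∑' p : A × B, h (p.1 + p.2) * h (p.1 - p.2) := by
    rw [ENNReal.tsum_prod', ← ENNReal.tsum_mul_right]
    refine tsum_congr fun x => ?_
    rw [← ENNReal.tsum_mul_left]
    exact tsum_congr fun y => hgh _ _
  set K : AddSubgroup E := (M ⊓ N).map (nsmulAddMonoidHom 2) with hK
  have memK (z : E) : z ∈ K ↔ ∃ k, (k ∈ M ∧ k ∈ N) ∧ 2 • k = z := by
    simp [hK, AddSubgroup.mem_map]
  have mk_eq (a b : E) : (a : E ⧸ K) = b ↔ ∃ k, (k ∈ M ∧ k ∈ N) ∧ 2 • k = -a + b := by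
    rw [QuotientAddGroup.eq, memK]
  let H : E ⧸ K → ℝ≥0∞ := fun q => ∑' u : L, if ((u : E) : E ⧸ K) = q then h u else 0
  have HH (q q' : E ⧸ K) : H q * H q' = ∑' p : L × L,
      if ((p.1 : E) : E ⧸ K) = q ∧ ((p.2 : E) : E ⧸ K) = q' then h p.1 * h p.2 else 0 := by
    rw [ENNReal.tsum_prod', ← ENNReal.tsum_mul_right]
    refine tsum_congr fun x => ?_
    rw [← ENNReal.tsum_mul_left]
    refine tsum_congr fun y => ?_
    by_cases h1 : ((x : E) : E ⧸ K) = q <;> by_cases h2 : ((y : E) : E ⧸ K) = q' <;> simp [h1, h2]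
  let r : M × N → (E ⧸ K) × (E ⧸ K) := fun p =>
    (((p.1 + p.2 : E) : E ⧸ K), ((p.1 - p.2 : E) : E ⧸ K))
  let R := Set.range r
  have swap (p p' : M × N) : (r p).1 = (r p').1 ↔ (r p).2 = (r p').2 := by
    obtain ⟨⟨x, hx⟩, ⟨y, hy⟩⟩ := p
    obtain ⟨⟨x', hx'⟩, ⟨y', hy'⟩⟩ := p'
    simp only [r, mk_eq]
    constructor
    · rintro ⟨k, ⟨hkM, hkN⟩, hk⟩
      have e : k - (y' - y) = (x' - x) - k := by
        rw [sub_eq_sub_iff_add_eq_add, ← two_nsmul, hk]; abel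
      refine ⟨k - (y' - y), ⟨?_, N.sub_mem hkN (N.sub_mem hy' hy)⟩, ?_⟩
      · rw [e]; exact M.sub_mem (M.sub_mem hx' hx) hkM
      · rw [nsmul_sub, hk, two_nsmul]; abel
    · rintro ⟨k, ⟨hkM, hkN⟩, hk⟩
      have e : k + (y' - y) = (x' - x) - k := by
        rw [eq_sub_iff_add_eq, add_right_comm, ← two_nsmul, hk]; abel
      refine ⟨k + (y' - y), ⟨?_, N.add_mem hkN (N.sub_mem hy' hy)⟩, ?_⟩
      · rw [e]; exact M.sub_mem (M.sub_mem hx' hx) hkM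
      · rw [nsmul_add, hk, two_nsmul]; abel
  have inj₁ : Function.Injective fun p : R => p.1.1 := by
    rintro ⟨_, p, rfl⟩ ⟨_, p', rfl⟩ e
    exact Subtype.ext (Prod.ext e ((swap p p').1 e))
  have inj₂ : Function.Injective fun p : R => p.1.2 := by
    rintro ⟨_, p, rfl⟩ ⟨_, p', rfl⟩ e
    exact Subtype.ext (Prod.ext ((swap p p').2 e) e)
  calc (∑' x : M, g x) * ∑' y : N, g y
      = ∑' p : M × N, h (p.1 + p.2) * h (p.1 - p.2) := prod M N
    _ ≤ ∑' p : R × (L × L), if ((p.2.1 : E) : E ⧸ K) = p.1.1.1 ∧ ((p.2.2 : E) : E ⧸ K) = p.1.1.2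
          then h p.2.1 * h p.2.2 else 0 := by
        let φ : M × N → R × (L × L) := fun p =>
          (⟨r p, p, rfl⟩, ⟨p.1 + p.2, L.add_mem (hM p.1.2) (hN p.2.2)⟩,
            ⟨p.1 - p.2, L.sub_mem (hM p.1.2) (hN p.2.2)⟩)
        have hφ : Function.Injective φ := by
          rintro ⟨⟨x, hx⟩, ⟨y, hy⟩⟩ ⟨⟨x', hx'⟩, ⟨y', hy'⟩⟩ e
          simp only [φ, Prod.mk.injEq, Subtype.mk.injEq] at e
          obtain ⟨-, e1, e2⟩ := e
          have ex : x = x' := inj2 <| by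
            rw [show 2 • x = (x + y) + (x - y) by rw [two_nsmul]; abel, e1, e2, two_nsmul]; abel
          subst ex
          simpa using e1
        refine le_trans (le_of_eq ?_) (ENNReal.tsum_comp_le_tsum_of_injective hφ _)
        simp [φ, r]
    _ = ∑' p : R, H p.1.1 * H p.1.2 := by
        rw [ENNReal.tsum_prod']
        exact tsum_congr fun p => (HH p.1.1 p.1.2).symm
    _ ≤ ∑' q, H q * H q := ENNReal.tsum_mul_le_tsum_mul_self_of_injective R inj₁ inj₂ H
    _ = ∑' p : L × L, if ((p.1 : E) : E ⧸ K) = ((p.2 : E) : E ⧸ K) then h p.1 * h p.2 else 0 := by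
        simp_rw [HH]
        rw [ENNReal.tsum_comm]
        refine tsum_congr fun p => ?_
        rw [tsum_eq_single ((p.2 : E) : E ⧸ K) fun q hq => if_neg fun e => hq e.2.symm]
        simp
    _ = ∑' p : {p : L × L | ((p.1 : E) : E ⧸ K) = ((p.2 : E) : E ⧸ K)}, h p.1.1 * h p.1.2 := by
        rw [tsum_subtype {p : L × L | ((p.1 : E) : E ⧸ K) = ((p.2 : E) : E ⧸ K)}
          fun p => h p.1 * h p.2]
        simp [Set.indicator_apply]
    _ ≤ ∑' p : L × (M ⊓ N : AddSubgroup E), h (p.1 + p.2) * h (p.1 - p.2) := by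
        have ex (p : {p : L × L | ((p.1 : E) : E ⧸ K) = ((p.2 : E) : E ⧸ K)}) :
            ∃ s : L × (M ⊓ N : AddSubgroup E),
              (s.1 + s.2 : E) = p.1.1 ∧ (s.1 - s.2 : E) = p.1.2 := by
          obtain ⟨⟨⟨u, hu⟩, ⟨v, hv⟩⟩, hp⟩ := p
          obtain ⟨k, hk, e⟩ := (mk_eq _ _).1 hp
          refine ⟨(⟨u + k, L.add_mem hu (hM hk.1)⟩, ⟨-k, (M ⊓ N).neg_mem hk⟩), by simp, ?_⟩
          have : v = u + 2 • k := by simp [e]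
          simp [this, two_nsmul, add_assoc]
        choose ψ hψ₁ hψ₂ using ex
        have hψ : Function.Injective ψ := fun p p' e =>
          Subtype.ext <| Prod.ext (Subtype.ext <| by rw [← hψ₁, ← hψ₁, e])
            (Subtype.ext <| by rw [← hψ₂, ← hψ₂, e])
        refine le_trans (le_of_eq (tsum_congr fun p => ?_))
          (ENNReal.tsum_comp_le_tsum_of_injective hψ _)
        rw [hψ₁, hψ₂]
    _ = _ := (prod L (M ⊓ N)).symm

theorem summable_exp_neg_pi_mul_norm_sq {E : Type*} [NormedAddCommGroup E] [NormedSpace ℝ E]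
    [FiniteDimensional ℝ E] (L : AddSubgroup E) [DiscreteTopology L] :
    Summable fun x : L => Real.exp (-Real.pi * ‖(x : E)‖ ^ 2) := by
  let L' : Submodule ℤ E := AddSubgroup.toIntSubmodule L
  have : DiscreteTopology L' := ‹DiscreteTopology L›
  set n := Module.finrank ℤ L' + 1
  have hs : Summable fun x : L => ‖(x : E)‖⁻¹ ^ (2 * n) :=
    ZLattice.summable_norm_pow_inv L' (2 * n) (by omega)
  refine Summable.of_norm_bounded_eventually (hs.mul_left (n.factorial / Real.pi ^ n)) ?_
  filter_upwards [(Set.finite_singleton (0 : L)).compl_mem_cofinite] with x hx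
  have hx : 0 < ‖(x : E)‖ := norm_pos_iff.2 fun e => hx (Subtype.ext e)
  have hp := Real.pi_pos
  rw [Real.norm_of_nonneg (Real.exp_pos _).le, neg_mul, Real.exp_neg]
  have hle := Real.pow_div_factorial_le_exp (Real.pi * ‖(x : E)‖ ^ 2) (by positivity) n
  refine (inv_anti₀ (by positivity) hle).trans (le_of_eq ?_)
  rw [mul_pow, ← pow_mul, inv_pow]
  field_simp

theorem gaussianMass_eq_toReal_tsum {E : Type*} [NormedAddCommGroup E] (S : Set E) :
    gaussianMass S =
      (∑' x : S, ENNReal.ofReal (Real.exp (-Real.pi * ‖(x : E)‖ ^ 2))).toReal := by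
  rw [gaussianMass, ENNReal.tsum_toReal_eq fun _ => ENNReal.ofReal_ne_top]
  exact tsum_congr fun x => (ENNReal.toReal_ofReal (Real.exp_pos _).le).symm

/-- The Regev–Stephens-Davidowitz inequality: if `M` and `N` are sublattices of a lattice
`L` in a finite-dimensional real inner product space, then
`ρ(M) · ρ(N) ≤ ρ(L) · ρ(M ∩ N)`. -/
theorem stmt10 {E : Type*}
    [NormedAddCommGroup E] [InnerProductSpace ℝ E] [FiniteDimensional ℝ E]
    (L M N : AddSubgroup E) [DiscreteTopology L] (hM : M ≤ L) (hN : N ≤ L) :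
    gaussianMass (M : Set E) * gaussianMass (N : Set E) ≤
      gaussianMass (L : Set E) * gaussianMass ((M ⊓ N : AddSubgroup E) : Set E) := by
  let g : E → ℝ≥0∞ := fun x => ENNReal.ofReal (Real.exp (-Real.pi * ‖x‖ ^ 2))
  have : IsAddTorsionFree E := .of_isTorsionFree ℝ E
  have hL : ∑' x : L, g x ≠ ∞ := (summable_exp_neg_pi_mul_norm_sq L).tsum_ofReal_ne_top
  have hMN : ∑' x : (M ⊓ N : AddSubgroup E), g x ≠ ∞ :=
    ne_top_of_le_ne_top hL (ENNReal.tsum_mono_subtype g (inf_le_left.trans hM : M ⊓ N ≤ L))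
  simp only [gaussianMass_eq_toReal_tsum, ← ENNReal.toReal_mul]
  refine ENNReal.toReal_mono (ENNReal.mul_ne_top hL hMN)
    (ENNReal.tsum_mul_tsum_le_of_mul_eq_add_sub L M N hM hN g
      (fun x => ENNReal.ofReal (Real.exp (-Real.pi * (‖x‖ ^ 2 / 2)))) fun x y => ?_)
  simp only [g]
  rw [← ENNReal.ofReal_mul (Real.exp_pos _).le, ← ENNReal.ofReal_mul (Real.exp_pos _).le,
    ← Real.exp_add, ← Real.exp_add]
  congr 2
  linear_combination (Real.pi / 2) * parallelogram_law_with_norm ℝ x y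
end

section
/- Let L, M, N be lattices in finite-dimensional real inner product spaces, and let f : L → M and g : M → N be group homomorphisms satisfying ‖f(x)‖ ≤ ‖x‖ for all x ∈ L and ‖g(y)‖ ≤ ‖y‖ for all y ∈ M. Then ρ(L) · ρ(ker g) ≤ ρ(M) · ρ(ker(g ∘ f)), where ker denotes the group-theoretic kernel; equivalently, ln ρ(L) − ln ρ(ker(g ∘ f)) ≤ ln ρ(M) − ln ρ(ker g). -/
open scoped ENNReal

/-- Summation over a group can be carried out over the cosets of an embedded group. -/
lemma tsum_eq_tsum_quotient_range {A B : Type*} [AddCommGroup A] [AddCommGroup B] (i : A →+ B)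
    (hi : Function.Injective i) (h : B → ℝ≥0∞) :
    ∑' b, h b = ∑' x : B ⧸ i.range, ∑' a, h (x.out + i a) := by
  have hbij : Function.Bijective (fun p : (B ⧸ i.range) × A => p.1.out + i p.2) := by
    constructor
    · rintro ⟨x, a⟩ ⟨y, b⟩ hxy
      have hxy' : x.out + i a = y.out + i b := hxy
      have hq : x = y := by
        rw [← QuotientAddGroup.out_eq' x, ← QuotientAddGroup.out_eq' y, QuotientAddGroup.eq]
        refine ⟨a - b, ?_⟩
        rw [map_sub, sub_eq_iff_eq_add, add_assoc, ← hxy']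
        abel
      subst hq
      exact Prod.ext rfl (hi (add_left_cancel hxy'))
    · intro b
      have hb : ((b : B ⧸ i.range).out : B ⧸ i.range) = (b : B ⧸ i.range) :=
        QuotientAddGroup.out_eq' _
      obtain ⟨a, ha⟩ := QuotientAddGroup.eq.1 hb
      exact ⟨((b : B ⧸ i.range), a), by simp [ha]⟩
  rw [← ENNReal.tsum_prod, ← (Equiv.ofBijective _ hbij).tsum_eq h]
  rfl

lemma ENNReal.two_mul_mul_le_add_sq (a b : ℝ≥0∞) : 2 * (a * b) ≤ a * a + b * b := by
  induction a with
  | top => simp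
  | coe a =>
    induction b with
    | top => simp
    | coe b =>
      have h := two_mul_le_add_sq a b
      exact_mod_cast (by simpa [mul_assoc, sq] using h : 2 * (a * b) ≤ a * a + b * b)

lemma tsum_mul_add_sub_eq_tsum_quotient {D : Type*} [AddCommGroup D] (δ : D →+ D)
    (hδ : ∀ a, δ a = a + a) (hinj : Function.Injective δ) (F G : D → ℝ≥0∞) :
    ∑' a, ∑' b, F (a + b) * G (a - b) =
      ∑' c : D ⧸ δ.range, (∑' d, F (c.out + δ d)) * ∑' d, G (c.out + δ d) := by
  have hshift (b : D) : ∑' a, F (a + b) * G (a - b) = ∑' u, F u * G (u - δ b) := by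
    rw [← (Equiv.addRight b).tsum_eq (fun u => F u * G (u - δ b))]
    refine tsum_congr fun a => ?_
    simp only [Equiv.coe_addRight, hδ, add_sub_add_right_eq_sub]
  rw [ENNReal.tsum_comm, tsum_congr hshift, ENNReal.tsum_comm, tsum_eq_tsum_quotient_range δ hinj]
  refine tsum_congr fun c => ?_
  rw [← ENNReal.tsum_mul_right]
  refine tsum_congr fun d => ?_
  rw [ENNReal.tsum_mul_left, ← (Equiv.subLeft d).tsum_eq (fun d => G (c.out + δ d))]
  congr 1
  refine tsum_congr fun b => ?_
  rw [Equiv.subLeft_apply, map_sub, add_sub_assoc]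

lemma two_mul_tsum_mul_add_sub_le {D : Type*} [AddCommGroup D]
    (hD : Function.Injective fun a : D => a + a) (F G : D → ℝ≥0∞) :
    2 * ∑' a, ∑' b, F (a + b) * G (a - b) ≤
      ∑' a, ∑' b, F (a + b) * F (a - b) + ∑' a, ∑' b, G (a + b) * G (a - b) := by
  let δ : D →+ D := AddMonoidHom.id D + AddMonoidHom.id D
  have hδ (a : D) : δ a = a + a := rfl
  simp only [tsum_mul_add_sub_eq_tsum_quotient δ hδ hD]
  rw [← ENNReal.tsum_mul_left, ← ENNReal.tsum_add]
  exact ENNReal.tsum_le_tsum fun c => ENNReal.two_mul_mul_le_add_sq _ _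

/-- The Regev–Stephens-Davidowitz inequality, in arithmetic-mean form, for a weight `w = r²` obeying
the parallelogram identity. -/
lemma two_mul_tsum_mul_tsum_le {D Λ : Type*} [AddCommGroup D] [AddCommGroup Λ]
    (hD : Function.Injective fun a : D => a + a) (j : D →+ Λ) (w r : Λ → ℝ≥0∞)
    (hr : ∀ x y, w x * w y = r (x + y) * r (x - y)) (x y : Λ) :
    2 * ((∑' a, w (x + j a)) * ∑' a, w (y + j a)) ≤
      (∑' a, w (j a)) * (∑' a, w (x + y + j a) + ∑' a, w (x - y + j a)) := by
  have hmul (u v : Λ) : (∑' a, w (u + j a)) * ∑' a, w (v + j a) =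
      ∑' a, ∑' b, r (u + v + j (a + b)) * r (u - v + j (a - b)) := by
    rw [← ENNReal.tsum_mul_right]
    refine tsum_congr fun a => ?_
    rw [← ENNReal.tsum_mul_left]
    refine tsum_congr fun b => ?_
    rw [hr, map_add, map_sub]
    congr 2 <;> abel
  have hsq (u : Λ) : (∑' a, w (j a)) * ∑' a, w (u + j a) =
      ∑' a, ∑' b, r (u + j (a + b)) * r (u + j (a - b)) := by
    simpa [mul_comm] using hmul u 0
  rw [hmul, mul_add, hsq, hsq]
  exact two_mul_tsum_mul_add_sub_le hD (fun a => r (x + y + j a)) (fun a => r (x - y + j a))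

/-- Submodularity: `ρ(A) ρ(B) ≤ ρ(A ∩ B) ρ(Λ)` for subgroups `A`, `B` of `Λ` with intersection `D`
and a weight `ρ` obeying the parallelogram identity. -/
lemma tsum_mul_tsum_le_tsum_inter_mul_tsum {D A B Λ : Type*} [AddCommGroup D] [AddCommGroup A]
    [AddCommGroup B] [AddCommGroup Λ] (hD : Function.Injective fun a : D => a + a)
    (iA : D →+ A) (iB : D →+ B) (jA : A →+ Λ) (jB : B →+ Λ)
    (hjA : Function.Injective jA) (hjB : Function.Injective jB)
    (hiA : Function.Injective iA) (hcomm : ∀ d, jA (iA d) = jB (iB d))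
    (hinter : ∀ a b, jA a = jB b → a ∈ iA.range) (w r : Λ → ℝ≥0∞)
    (hr : ∀ x y, w x * w y = r (x + y) * r (x - y)) :
    (∑' a, w (jA a)) * ∑' b, w (jB b) ≤ (∑' d, w (jA (iA d))) * ∑' x, w x := by
  have hiB : Function.Injective iB := fun d e h =>
    hiA (hjA (by rw [hcomm, hcomm, h]))
  have hcancel (x x' : A ⧸ iA.range) (b : B) (h : jA x.out = jA x'.out + jB b) : x = x' := by
    rw [← QuotientAddGroup.out_eq' x, ← QuotientAddGroup.out_eq' x', eq_comm, QuotientAddGroup.eq]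
    refine hinter _ b ?_
    rw [map_add, map_neg, h, neg_add_cancel_left]
  have hcancel' (y y' : B ⧸ iB.range) (d d' : D)
      (h : jB y.out + jA (iA d) = jB y'.out + jA (iA d')) : y = y' ∧ d = d' := by
    rw [hcomm, hcomm, ← map_add, ← map_add] at h
    have h' := hjB h
    have hy : y = y' := by
      rw [← QuotientAddGroup.out_eq' y, ← QuotientAddGroup.out_eq' y', QuotientAddGroup.eq]
      refine ⟨d - d', ?_⟩
      rw [map_sub, sub_eq_iff_eq_add, add_assoc, ← h']
      abel
    subst hy
    exact ⟨rfl, hiB (add_left_cancel h')⟩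
  have hplus : ∑' x : A ⧸ iA.range, ∑' y : B ⧸ iB.range,
      ∑' d, w (jA x.out + jB y.out + jA (iA d)) ≤ ∑' x, w x := by
    simp only [← ENNReal.tsum_prod]
    refine ENNReal.tsum_comp_le_tsum_of_injective
      (f := fun p : (A ⧸ iA.range) × (B ⧸ iB.range) × D =>
        jA p.1.out + jB p.2.1.out + jA (iA p.2.2)) ?_ w
    rintro ⟨x, y, d⟩ ⟨x', y', d'⟩ h
    have h : jA x.out + jB y.out + jA (iA d) = jA x'.out + jB y'.out + jA (iA d') := h
    obtain rfl : x = x' := by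
      refine hcancel x x' (y'.out + iB d' - (y.out + iB d)) ?_
      rw [map_sub, map_add, map_add, ← hcomm, ← hcomm, ← add_sub_assoc, ← add_assoc, ← h]
      abel
    obtain ⟨rfl, rfl⟩ := hcancel' y y' d d' (by simpa [add_assoc] using h)
    rfl
  have hminus : ∑' x : A ⧸ iA.range, ∑' y : B ⧸ iB.range,
      ∑' d, w (jA x.out - jB y.out + jA (iA d)) ≤ ∑' x, w x := by
    simp only [← ENNReal.tsum_prod]
    refine ENNReal.tsum_comp_le_tsum_of_injective
      (f := fun p : (A ⧸ iA.range) × (B ⧸ iB.range) × D =>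
        jA p.1.out - jB p.2.1.out + jA (iA p.2.2)) ?_ w
    rintro ⟨x, y, d⟩ ⟨x', y', d'⟩ h
    have h : jA x.out - jB y.out + jA (iA d) = jA x'.out - jB y'.out + jA (iA d') := h
    obtain rfl : x = x' := by
      refine hcancel x x' (-y'.out + iB d' - (-y.out + iB d)) ?_
      rw [map_sub, map_add, map_add, map_neg, map_neg, ← hcomm, ← hcomm, ← add_sub_assoc,
        ← add_assoc, ← sub_eq_add_neg, ← h]
      abel
    have h2 : jB y.out + jA (iA d') = jB y'.out + jA (iA d) := by
      rw [sub_eq_add_neg, sub_eq_add_neg, add_assoc, add_assoc, add_right_inj,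
        neg_add_eq_iff_eq_add] at h
      rw [h]
      abel
    obtain ⟨rfl, rfl⟩ := hcancel' y y' d' d h2
    rfl
  have hA : ∑' a, w (jA a) = ∑' x : A ⧸ iA.range, ∑' d, w (jA x.out + jA (iA d)) := by
    simp only [tsum_eq_tsum_quotient_range iA hiA (fun a => w (jA a)), map_add]
  have hB : ∑' b, w (jB b) = ∑' y : B ⧸ iB.range, ∑' d, w (jB y.out + jA (iA d)) := by
    simp only [tsum_eq_tsum_quotient_range iB hiB (fun b => w (jB b)), map_add, hcomm]
  have hmain : 2 * ((∑' a, w (jA a)) * ∑' b, w (jB b)) ≤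
      2 * ((∑' d, w (jA (iA d))) * ∑' x, w x) := by
    calc 2 * ((∑' a, w (jA a)) * ∑' b, w (jB b))
        = ∑' x : A ⧸ iA.range, ∑' y : B ⧸ iB.range,
            2 * ((∑' d, w (jA x.out + jA (iA d))) * ∑' d, w (jB y.out + jA (iA d))) := by
          simp only [hA, hB, ENNReal.tsum_mul_left, ENNReal.tsum_mul_right]
      _ ≤ ∑' x : A ⧸ iA.range, ∑' y : B ⧸ iB.range, (∑' d, w (jA (iA d))) *
            (∑' d, w (jA x.out + jB y.out + jA (iA d)) +
              ∑' d, w (jA x.out - jB y.out + jA (iA d))) :=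
          ENNReal.tsum_le_tsum fun x => ENNReal.tsum_le_tsum fun y =>
            two_mul_tsum_mul_tsum_le hD (jA.comp iA) w r hr _ _
      _ = (∑' d, w (jA (iA d))) *
            (∑' x : A ⧸ iA.range, ∑' y : B ⧸ iB.range,
                ∑' d, w (jA x.out + jB y.out + jA (iA d)) +
              ∑' x : A ⧸ iA.range, ∑' y : B ⧸ iB.range,
                ∑' d, w (jA x.out - jB y.out + jA (iA d))) := by
          simp only [ENNReal.tsum_mul_left, ENNReal.tsum_add]
      _ ≤ (∑' d, w (jA (iA d))) * (∑' x, w x + ∑' x, w x) := by gcongr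
      _ = 2 * ((∑' d, w (jA (iA d))) * ∑' x, w x) := by ring
  exact (ENNReal.mul_le_mul_iff_right two_ne_zero ENNReal.ofNat_ne_top).1 hmain

lemma summable_exp_neg_mul_sq_norm {E : Type*} [NormedAddCommGroup E] [InnerProductSpace ℝ E]
    [FiniteDimensional ℝ E] (L : AddSubgroup E) [DiscreteTopology L] {c : ℝ} (hc : 0 < c) :
    Summable fun x : L => Real.exp (-c * ‖(x : E)‖ ^ 2) := by
  let L' : Submodule ℤ E := AddSubgroup.toIntSubmodule L
  have : DiscreteTopology L' := inferInstanceAs (DiscreteTopology L)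
  set n : ℕ := Module.finrank ℤ L' + 1 with hn
  have hs : Summable fun x : L => ‖(x : E)‖ ^ (-(2 * n : ℤ)) :=
    ZLattice.summable_norm_zpow L' (-(2 * n : ℤ)) (by push_cast [hn]; omega)
  refine Summable.of_norm_bounded_eventually (hs.mul_left (n.factorial / c ^ n)) ?_
  filter_upwards [(Set.finite_singleton (0 : L)).compl_mem_cofinite] with x hx
  have hx0 : 0 < ‖(x : E)‖ := by
    rw [norm_pos_iff]
    exact fun h => hx (Subtype.ext h)
  have h := Real.pow_div_factorial_le_exp (c * ‖(x : E)‖ ^ 2) (by positivity) n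
  rw [Real.norm_eq_abs, Real.abs_exp, neg_mul, Real.exp_neg]
  refine (inv_anti₀ (by positivity) h).trans_eq ?_
  rw [zpow_neg, inv_div, mul_pow, ← pow_mul]
  have hpow : ‖(x : E)‖ ^ (2 * n : ℤ) = ‖(x : E)‖ ^ (2 * n) := by
    rw [← zpow_natCast]
    norm_cast
  rw [hpow]
  field_simp

/-- The Gaussian inequality for a strict contraction, obtained by rescaling the norm of `L`. -/
lemma tsum_exp_mul_tsum_ker_le {E F G : Type*}
    [NormedAddCommGroup E] [InnerProductSpace ℝ E] [FiniteDimensional ℝ E]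
    [NormedAddCommGroup F] [InnerProductSpace ℝ F] [FiniteDimensional ℝ F]
    [AddCommGroup G]
    (L : AddSubgroup E) (M : AddSubgroup F) [DiscreteTopology L] [DiscreteTopology M]
    (f : L →+ M) (g : M →+ G) (hf : ∀ x : L, ‖(f x : F)‖ ≤ ‖(x : E)‖) {ε : ℝ} (hε : 0 < ε) :
    (∑' x : L, Real.exp (-Real.pi * ((1 + ε) * ‖(x : E)‖ ^ 2))) *
        ∑' y : g.ker, Real.exp (-Real.pi * ‖(y : F)‖ ^ 2) ≤
      (∑' x : (g.comp f).ker, Real.exp (-Real.pi * ((1 + ε) * ‖(x : E)‖ ^ 2))) *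
        ∑' y : M, Real.exp (-Real.pi * ‖(y : F)‖ ^ 2) := by
  let q : L → ℝ := fun x => (1 + ε) * ‖(x : E)‖ ^ 2 - ‖(f x : F)‖ ^ 2
  let Q : L × M → ℝ := fun z => q z.1 + ‖(z.2 : F)‖ ^ 2
  have hQ (z z' : L × M) : Q (z + z') + Q (z - z') = 2 * (Q z + Q z') := by
    have h1 := parallelogram_law_with_norm ℝ (z.1 : E) z'.1
    have h2 := parallelogram_law_with_norm ℝ (f z.1 : F) (f z'.1)
    have h3 := parallelogram_law_with_norm ℝ (z.2 : F) z'.2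
    simp only [Q, q, Prod.fst_add, Prod.fst_sub, Prod.snd_add, Prod.snd_sub, map_add, map_sub,
      AddSubgroup.coe_add, AddSubgroup.coe_sub]
    linear_combination (1 + ε) * h1 - h2 + h3
  let w : L × M → ℝ≥0∞ := fun z => ENNReal.ofReal (Real.exp (-Real.pi * Q z))
  let r : L × M → ℝ≥0∞ := fun z => ENNReal.ofReal (Real.exp (-Real.pi * Q z / 2))
  have hr (z z' : L × M) : w z * w z' = r (z + z') * r (z - z') := by
    simp only [w, r, ← ENNReal.ofReal_mul (Real.exp_nonneg _), ← Real.exp_add]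
    congr 2
    linear_combination (Real.pi / 2) * hQ z z'
  have hqsum : Summable fun x : L => Real.exp (-Real.pi * q x) := by
    refine Summable.of_nonneg_of_le (fun _ => Real.exp_nonneg _) (fun x => ?_)
      (summable_exp_neg_mul_sq_norm L (mul_pos Real.pi_pos hε))
    have h := pow_le_pow_left₀ (norm_nonneg _) (hf x) 2
    rw [Real.exp_le_exp, neg_mul, neg_mul, neg_le_neg_iff, mul_assoc]
    refine mul_le_mul_of_nonneg_left ?_ Real.pi_pos.le
    simp only [q]
    linarith
  have hMsum := summable_exp_neg_mul_sq_norm M Real.pi_pos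
  have hKsum : Summable fun y : g.ker => Real.exp (-Real.pi * ‖(y : F)‖ ^ 2) :=
    hMsum.comp_injective Subtype.val_injective
  have hLsum : Summable fun x : L => Real.exp (-Real.pi * ((1 + ε) * ‖(x : E)‖ ^ 2)) := by
    simpa only [neg_mul, mul_assoc] using
      summable_exp_neg_mul_sq_norm L (c := Real.pi * (1 + ε)) (by positivity)
  have hDsum : Summable fun x : (g.comp f).ker =>
      Real.exp (-Real.pi * ((1 + ε) * ‖(x : E)‖ ^ 2)) :=
    hLsum.comp_injective Subtype.val_injective
  have hw (x : L) (y : M) : w (x, y) = ENNReal.ofReal (Real.exp (-Real.pi * q x)) *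
      ENNReal.ofReal (Real.exp (-Real.pi * ‖(y : F)‖ ^ 2)) := by
    rw [← ENNReal.ofReal_mul (Real.exp_nonneg _), ← Real.exp_add, ← mul_add]
  have hwgraph (x : L) : w (x, f x) =
      ENNReal.ofReal (Real.exp (-Real.pi * ((1 + ε) * ‖(x : E)‖ ^ 2))) := by
    simp [w, Q, q]
  have hdouble : Function.Injective fun a : (g.comp f).ker => a + a := by
    intro a b hab
    have h : (a : E) + a = b + b := congrArg (fun x : (g.comp f).ker => (x : E)) hab
    rw [← two_smul ℝ, ← two_smul ℝ] at h
    exact Subtype.ext (Subtype.ext (smul_right_injective E two_ne_zero h))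
  have key := tsum_mul_tsum_le_tsum_inter_mul_tsum hdouble (g.comp f).ker.subtype
    (((g.comp f).ker.subtype).prod ((f.comp (g.comp f).ker.subtype).codRestrict g.ker
      fun x => x.2))
    ((AddMonoidHom.id L).prod f) ((AddMonoidHom.id L).prodMap g.ker.subtype)
    (fun x y h => (Prod.ext_iff.1 h).1)
    (fun x y h => Prod.ext (Prod.ext_iff.1 h).1 (Subtype.ext (Prod.ext_iff.1 h).2))
    Subtype.val_injective (fun _ => rfl)
    (fun x p h => by
      have h2 : f x = p.2 := congrArg Prod.snd h
      exact ⟨⟨x, by simp only [AddMonoidHom.mem_ker, AddMonoidHom.comp_apply, h2]; exact p.2.2⟩,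
        rfl⟩)
    w r hr
  have hP : ∑' p : L × g.ker, w (((AddMonoidHom.id L).prodMap g.ker.subtype) p) =
      ENNReal.ofReal (∑' x, Real.exp (-Real.pi * q x)) *
        ENNReal.ofReal (∑' y : g.ker, Real.exp (-Real.pi * ‖(y : F)‖ ^ 2)) := by
    rw [ENNReal.ofReal_tsum_of_nonneg (fun _ => Real.exp_nonneg _) hqsum,
      ENNReal.ofReal_tsum_of_nonneg (fun _ => Real.exp_nonneg _) hKsum, ENNReal.tsum_prod',
      ← ENNReal.tsum_mul_right]
    refine tsum_congr fun x => ?_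
    rw [← ENNReal.tsum_mul_left]
    exact tsum_congr fun y => hw x y
  have hΛ : ∑' z, w z = ENNReal.ofReal (∑' x, Real.exp (-Real.pi * q x)) *
        ENNReal.ofReal (∑' y : M, Real.exp (-Real.pi * ‖(y : F)‖ ^ 2)) := by
    rw [ENNReal.ofReal_tsum_of_nonneg (fun _ => Real.exp_nonneg _) hqsum,
      ENNReal.ofReal_tsum_of_nonneg (fun _ => Real.exp_nonneg _) hMsum, ENNReal.tsum_prod',
      ← ENNReal.tsum_mul_right]
    refine tsum_congr fun x => ?_
    rw [← ENNReal.tsum_mul_left]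
    exact tsum_congr fun y => hw x y
  have hG : ∑' x, w ((AddMonoidHom.id L).prod f x) =
      ENNReal.ofReal (∑' x : L, Real.exp (-Real.pi * ((1 + ε) * ‖(x : E)‖ ^ 2))) := by
    rw [ENNReal.ofReal_tsum_of_nonneg (fun _ => Real.exp_nonneg _) hLsum]
    exact tsum_congr hwgraph
  have hD : ∑' x, w ((AddMonoidHom.id L).prod f ((g.comp f).ker.subtype x)) = ENNReal.ofReal
      (∑' x : (g.comp f).ker, Real.exp (-Real.pi * ((1 + ε) * ‖(x : E)‖ ^ 2))) := by
    rw [ENNReal.ofReal_tsum_of_nonneg (fun _ => Real.exp_nonneg _) hDsum]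
    exact tsum_congr fun x => hwgraph x
  have hqpos : 0 < ∑' x, Real.exp (-Real.pi * q x) :=
    hqsum.tsum_pos (fun _ => Real.exp_nonneg _) 0 (Real.exp_pos _)
  have hnonneg {ι : Type _} (u : ι → ℝ) : 0 ≤ ∑' i, Real.exp (u i) :=
    tsum_nonneg fun _ => Real.exp_nonneg _
  rw [hG, hP, hD, hΛ, ← ENNReal.ofReal_mul (hnonneg _), ← ENNReal.ofReal_mul (hnonneg _),
    ← ENNReal.ofReal_mul (hnonneg _), ← ENNReal.ofReal_mul (hnonneg _),
    ENNReal.ofReal_le_ofReal_iff (mul_nonneg (tsum_nonneg fun _ => Real.exp_nonneg _)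
      (mul_nonneg (tsum_nonneg fun _ => Real.exp_nonneg _)
        (tsum_nonneg fun _ => Real.exp_nonneg _))), mul_left_comm,
    mul_left_comm _ (∑' x, Real.exp (-Real.pi * q x))] at key
  exact le_of_mul_le_mul_left key hqpos

/-- If `f : L → M` and `g : M → N` are lattice homomorphisms (norm-nonincreasing group
homomorphisms between lattices), then `ρ(L)·ρ(ker g) ≤ ρ(M)·ρ(ker (g ∘ f))`. -/
theorem stmt11 {E F G : Type*}
    [NormedAddCommGroup E] [InnerProductSpace ℝ E] [FiniteDimensional ℝ E]
    [NormedAddCommGroup F] [InnerProductSpace ℝ F] [FiniteDimensional ℝ F]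
    [NormedAddCommGroup G] [InnerProductSpace ℝ G] [FiniteDimensional ℝ G]
    (L : AddSubgroup E) (M : AddSubgroup F) (N : AddSubgroup G)
    [DiscreteTopology L] [DiscreteTopology M] [DiscreteTopology N]
    (f : L →+ M) (g : M →+ N)
    (hf : ∀ x : L, ‖(f x : F)‖ ≤ ‖(x : E)‖)
    (hg : ∀ y : M, ‖(g y : G)‖ ≤ ‖(y : F)‖) :
    gaussianMass (L : Set E) * gaussianMass ((g.ker : Set M)) ≤
      gaussianMass (M : Set F) * gaussianMass (((g.comp f).ker : Set L)) := by
  have hLsum := summable_exp_neg_mul_sq_norm L Real.pi_pos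
  have hle {ε : ℝ} (hε : 0 < ε) (x : L) :
      Real.exp (-Real.pi * ((1 + ε) * ‖(x : E)‖ ^ 2)) ≤ Real.exp (-Real.pi * ‖(x : E)‖ ^ 2) := by
    rw [Real.exp_le_exp, neg_mul, neg_mul, neg_le_neg_iff]
    refine mul_le_mul_of_nonneg_left ?_ Real.pi_pos.le
    nlinarith [sq_nonneg ‖(x : E)‖]
  have hlim : Filter.Tendsto
      (fun ε : ℝ => ∑' x : L, Real.exp (-Real.pi * ((1 + ε) * ‖(x : E)‖ ^ 2)))
      (nhdsWithin 0 (Set.Ioi 0)) (nhds (gaussianMass (L : Set E))) := by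
    refine tendsto_tsum_of_dominated_convergence hLsum (fun x => ?_) ?_
    · have hcont : Continuous fun ε : ℝ => Real.exp (-Real.pi * ((1 + ε) * ‖(x : E)‖ ^ 2)) := by
        fun_prop
      simpa using (hcont.tendsto 0).mono_left nhdsWithin_le_nhds
    · filter_upwards [self_mem_nhdsWithin] with ε hε x
      rw [Real.norm_eq_abs, Real.abs_exp]
      exact hle hε x
  refine le_of_tendsto (hlim.mul_const _) ?_
  filter_upwards [self_mem_nhdsWithin] with ε hε
  refine (tsum_exp_mul_tsum_ker_le L M f g hf hε).trans ?_
  rw [mul_comm]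
  refine mul_le_mul_of_nonneg_left ?_ (tsum_nonneg fun _ => Real.exp_nonneg _)
  have hDsum : Summable fun x : (g.comp f).ker => Real.exp (-Real.pi * ‖(x : E)‖ ^ 2) :=
    hLsum.comp_injective Subtype.val_injective
  exact Summable.tsum_le_tsum (fun x => hle hε x)
    (Summable.of_nonneg_of_le (fun _ => Real.exp_nonneg _) (fun x => hle hε x) hDsum) hDsum
end

section
/- Let a > 0 and b be real numbers, and let σ : ℝ → ℝ be given by σ(x) = e^{−π(ax+b)²}. Then |Σ_{n∈ℤ} σ(n) − 1/a| ≤ 2. -/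
open MeasureTheory Filter Topology

/-- The Gaussian `e^{-π x²}` is integrable. -/
lemma integrable_exp_neg_pi_mul_sq :
    Integrable (fun x : ℝ => Real.exp (-Real.pi * x ^ 2)) :=
  integrable_exp_neg_mul_sq Real.pi_pos

/-- The affine Gaussian is decreasing to the right of its peak. -/
lemma antitoneOn_exp_neg_pi_mul_affine_sq {a s : ℝ} (ha : 0 < a) (hs : 0 ≤ s) :
    AntitoneOn (fun x : ℝ => Real.exp (-Real.pi * (a * x + s) ^ 2)) (Set.Ici 0) := by
  intro x hx y _ hxy
  have hx : 0 ≤ x := hx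
  have h : (a * x + s) ^ 2 ≤ (a * y + s) ^ 2 := by gcongr
  simp only [Real.exp_le_exp]
  nlinarith [Real.pi_pos]

/-- Comparison of a one-sided Gaussian sum with the corresponding integral. -/
lemma gaussian_nat_tsum_bounds {a s : ℝ} (ha : 0 < a) (hs : 0 ≤ s) :
    Summable (fun n : ℕ => Real.exp (-Real.pi * (a * n + s) ^ 2)) ∧
    a⁻¹ * (∫ x in Set.Ioi s, Real.exp (-Real.pi * x ^ 2)) ≤
      ∑' n : ℕ, Real.exp (-Real.pi * (a * n + s) ^ 2) ∧
    ∑' n : ℕ, Real.exp (-Real.pi * (a * n + s) ^ 2) ≤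
      1 + a⁻¹ * ∫ x in Set.Ioi s, Real.exp (-Real.pi * x ^ 2) := by
  have hanti := antitoneOn_exp_neg_pi_mul_affine_sq ha hs
  have hint (N : ℕ) : ∫ x in (0 : ℝ)..N, Real.exp (-Real.pi * (a * x + s) ^ 2) =
      a⁻¹ * ∫ x in s..(a * N + s), Real.exp (-Real.pi * x ^ 2) := by
    have := intervalIntegral.integral_comp_mul_add (a := 0) (b := N)
      (fun x : ℝ => Real.exp (-Real.pi * x ^ 2)) ha.ne' s
    simpa using this
  have hlim : Tendsto (fun N : ℕ => ∫ x in s..(a * N + s), Real.exp (-Real.pi * x ^ 2)) atTop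
      (𝓝 (∫ x in Set.Ioi s, Real.exp (-Real.pi * x ^ 2))) :=
    intervalIntegral_tendsto_integral_Ioi s integrable_exp_neg_pi_mul_sq.integrableOn
      (tendsto_atTop_add_const_right _ _
        (tendsto_natCast_atTop_atTop.const_mul_atTop ha))
  have hle (N : ℕ) : ∑ n ∈ Finset.range N, Real.exp (-Real.pi * (a * n + s) ^ 2) ≤
      1 + a⁻¹ * ∫ x in Set.Ioi s, Real.exp (-Real.pi * x ^ 2) := by
    have h₁ := AntitoneOn.sum_le_integral (x₀ := 0) (a := N)
      (hanti.mono Set.Icc_subset_Ici_self)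
    simp only [zero_add, hint] at h₁
    have h₂ : ∫ x in s..(a * N + s), Real.exp (-Real.pi * x ^ 2) ≤
        ∫ x in Set.Ioi s, Real.exp (-Real.pi * x ^ 2) := by
      rw [intervalIntegral.integral_of_le (le_add_of_nonneg_left (by positivity))]
      exact setIntegral_mono_set integrable_exp_neg_pi_mul_sq.integrableOn
        (ae_of_all _ fun _ => (Real.exp_pos _).le)
        (LE.le.eventuallyLE Set.Ioc_subset_Ioi_self)
    have h₃ : Real.exp (-Real.pi * (a * (0 : ℕ) + s) ^ 2) ≤ 1 :=
      Real.exp_le_one_iff.mpr (by nlinarith [Real.pi_pos, sq_nonneg (a * (0 : ℕ) + s)])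
    calc _ ≤ ∑ n ∈ Finset.range (N + 1), Real.exp (-Real.pi * (a * n + s) ^ 2) :=
          Finset.sum_le_sum_of_subset_of_nonneg (by simp) fun _ _ _ => (Real.exp_pos _).le
      _ ≤ _ := by
          rw [Finset.sum_range_succ', add_comm]
          exact add_le_add h₃ (h₁.trans (mul_le_mul_of_nonneg_left h₂ (inv_nonneg.mpr ha.le)))
  have hsum : Summable (fun n : ℕ => Real.exp (-Real.pi * (a * n + s) ^ 2)) :=
    summable_of_sum_range_le (fun _ => (Real.exp_pos _).le) hle
  refine ⟨hsum, le_of_tendsto_of_tendsto' (hlim.const_mul _) hsum.hasSum.tendsto_sum_nat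
    fun N => ?_, hsum.tsum_le_of_sum_range_le hle⟩
  have h := AntitoneOn.integral_le_sum (x₀ := 0) (a := N) (hanti.mono Set.Icc_subset_Ici_self)
  simpa only [zero_add, hint] using h

/-- Splitting the Gaussian integral, of total mass `1`, at `c` and `c + a`. -/
lemma gaussian_integral_tails_bounds {a : ℝ} (ha : 0 < a) (c : ℝ) :
    (∫ x in Set.Ioi (-c), Real.exp (-Real.pi * x ^ 2)) +
        (∫ x in Set.Ioi (a + c), Real.exp (-Real.pi * x ^ 2)) ≤ 1 ∧
    1 ≤ (∫ x in Set.Ioi (-c), Real.exp (-Real.pi * x ^ 2)) +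
        (∫ x in Set.Ioi (a + c), Real.exp (-Real.pi * x ^ 2)) + a := by
  have hg := integrable_exp_neg_pi_mul_sq
  have htot : ∫ x : ℝ, Real.exp (-Real.pi * x ^ 2) = 1 := by
    rw [integral_gaussian, div_self Real.pi_ne_zero, Real.sqrt_one]
  have hneg : ∫ x in Set.Ioi (-c), Real.exp (-Real.pi * x ^ 2) =
      ∫ x in Set.Iic c, Real.exp (-Real.pi * x ^ 2) := by
    rw [← integral_comp_neg_Iic c fun x : ℝ => Real.exp (-Real.pi * x ^ 2)]
    simp only [neg_sq]
  have h₁ := intervalIntegral.integral_Iic_add_Ioi (b := c) hg.integrableOn hg.integrableOn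
  have h₂ := intervalIntegral.integral_interval_add_Ioi (a := c) (b := a + c)
    hg.integrableOn hg.integrableOn
  have h₃ : 0 ≤ ∫ x in c..(a + c), Real.exp (-Real.pi * x ^ 2) :=
    intervalIntegral.integral_nonneg (by linarith) fun _ _ => (Real.exp_pos _).le
  have h₄ : ∫ x in c..(a + c), Real.exp (-Real.pi * x ^ 2) ≤ ∫ _ in c..(a + c), (1 : ℝ) :=
    intervalIntegral.integral_mono_on (by linarith) hg.intervalIntegrable (by simp) fun x _ =>
      Real.exp_le_one_iff.mpr (by nlinarith [Real.pi_pos, sq_nonneg x])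
  simp only [intervalIntegral.integral_const, smul_eq_mul, mul_one, add_sub_cancel_right] at h₄
  rw [hneg]
  constructor <;> linarith

/-- For `σ(x) = e^{-π (a x + b)²}` with `a > 0`, the sum of `σ` over the integers differs
from `1/a` by at most `2`. -/
theorem stmt15 (a b : ℝ) (ha : 0 < a) :
    |(∑' n : ℤ, Real.exp (-Real.pi * (a * (n : ℝ) + b) ^ 2)) - 1 / a| ≤ 2 := by
  set m : ℤ := ⌊-b / a⌋ with hm
  set c : ℝ := a * m + b with hc
  have hc₀ : 0 ≤ -c := by
    have := (le_div_iff₀ ha).mp (Int.floor_le (-b / a))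
    rw [← hm] at this
    linarith
  have hc₁ : 0 ≤ a + c := by
    have := (div_lt_iff₀ ha).mp (Int.lt_floor_add_one (-b / a))
    rw [← hm] at this
    linarith
  obtain ⟨hs₁, hl₁, hu₁⟩ := gaussian_nat_tsum_bounds ha hc₁
  obtain ⟨hs₀, hl₀, hu₀⟩ := gaussian_nat_tsum_bounds ha hc₀
  obtain ⟨hu, hl⟩ := gaussian_integral_tails_bounds ha c
  have hsplit : ∑' n : ℤ, Real.exp (-Real.pi * (a * (n : ℝ) + b) ^ 2) =
      (∑' n : ℕ, Real.exp (-Real.pi * (a * n + (a + c)) ^ 2)) +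
        ∑' n : ℕ, Real.exp (-Real.pi * (a * n + -c) ^ 2) := by
    rw [← (Equiv.addRight (m + 1)).tsum_eq]
    refine (HasSum.of_nat_of_neg_add_one ?_ ?_).tsum_eq
    · convert hs₁.hasSum using 4 with n
      simp [hc]
      ring
    · convert hs₀.hasSum using 4 with n
      simp [hc]
      ring
  have hu' := mul_le_mul_of_nonneg_left hu (inv_nonneg.mpr ha.le)
  have hl' := mul_le_mul_of_nonneg_left hl (inv_nonneg.mpr ha.le)
  simp only [mul_add, mul_one, inv_mul_cancel₀ ha.ne'] at hu' hl'
  rw [hsplit, one_div, abs_le]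
  constructor <;> linarith
end
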